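/- Let G be a finitely presentable group and let H be a subgroup of G of finite index d = [G:H]. Then T_∞(H) = d · T_∞(G), i.e., the stable presentation length is multiplicative on finite-index subgroups. -/

import Mathlib

/-- The set of values `Σ_i max(0, |r_i| - 2)` attained by finite presentations of `G`. -/
def presLengthValues (G : Type*) [Group G] : Set ℕ :=
  { t | ∃ (n : ℕ) (rels : List (FreeGroup (Fin n))),
      Nonempty (G ≃* PresentedGroup {r | r ∈ rels}) ∧
      t = (rels.map (fun r => FreeGroup.norm r - 2)).sum }

/-- A group is finitely presentable if it admits a finite presentation. -/
def FinitelyPresentable (G : Type*) [Group G] : Prop :=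
  (presLengthValues G).Nonempty

/-- The presentation length (Delzant's T-invariant) of a group. -/
noncomputable def presLength (G : Type*) [Group G] : ℕ :=
  sInf (presLengthValues G)

/-- The stable presentation length of a group. -/
noncomputable def stablePresLength (G : Type*) [Group G] : ℝ :=
  sInf { x : ℝ | ∃ H : Subgroup G, H.index ≠ 0 ∧
      x = (presLength H : ℝ) / (H.index : ℝ) }

section SchreierTree

variable {G X ι : Type*} [Group G] [MulAction G X]

/-- A Schreier transversal: coset representatives along a spanning tree of the Schreier graph.
The last clause is induction along the tree. -/
theorem exists_schreierTransversal [MulAction.IsPretransitive G X] (γ : ι → G)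
    (hγ : Subgroup.closure (Set.range γ) = ⊤) (x₀ : X) :
    ∃ t : X → G, t x₀ = 1 ∧ (∀ x, (t x)⁻¹ • x₀ = x) ∧
      ∀ p : X → Prop, p x₀ →
        (∀ y i, t ((γ i)⁻¹ • y) = t y * γ i → (p y ↔ p ((γ i)⁻¹ • y))) → ∀ x, p x := by
  classical
  let good (x : X) (k : ℕ) : Prop := ∃ l : List G, l.length = k ∧
    (∀ a ∈ l, a ∈ Set.range γ ∨ a⁻¹ ∈ Set.range γ) ∧ l.prod • x₀ = x
  have hgood : ∀ x, ∃ k, good x k := by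
    intro x
    obtain ⟨g, rfl⟩ := MulAction.exists_smul_eq G x₀ x
    obtain ⟨l, hl, hg⟩ := Submonoid.exists_list_of_mem_closure
      (s := Set.range γ ∪ (Set.range γ)⁻¹) (x := g)
      (by rw [← Subgroup.closure_toSubmonoid, hγ]; trivial)
    exact ⟨l.length, l, rfl, hl, by rw [hg]⟩
  let rank (x : X) : ℕ := Nat.find (hgood x)
  have hstep : ∀ x, x ≠ x₀ → ∃ y a, rank y < rank x ∧
      (a ∈ Set.range γ ∨ a⁻¹ ∈ Set.range γ) ∧ a • y = x := by
    intro x hx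
    obtain ⟨l, hlen, hl, hprod⟩ := Nat.find_spec (hgood x)
    cases l with
    | nil => exact absurd hprod (by simpa using hx.symm)
    | cons a l =>
      refine ⟨l.prod • x₀, a, ?_, hl a (by simp), by simpa [mul_smul] using hprod⟩
      have h1 : rank (l.prod • x₀) ≤ l.length :=
        Nat.find_min' _ ⟨l, rfl, fun b hb => hl b (by simp [hb]), rfl⟩
      have h2 : rank x = l.length + 1 := by simpa using hlen.symm
      omega
  choose! parent letter hlt hletter hsmul using hstep
  have wf : WellFounded fun x y : X => rank x < rank y := (measure rank).wf
  let t : X → G := wf.fix fun x rec =>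
    if h : x = x₀ then 1 else rec (parent x) (hlt x h) * (letter x)⁻¹
  have ht₀ : t x₀ = 1 := by simp only [t]; rw [wf.fix_eq]; simp
  have ht : ∀ x, x ≠ x₀ → t x = t (parent x) * (letter x)⁻¹ := by
    intro x hx; simp only [t]; rw [wf.fix_eq]; simp [hx]
  refine ⟨t, ht₀, fun x => ?_, fun p hp₀ hp x => ?_⟩
  · induction x using wf.induction with
    | _ x ih =>
      by_cases hx : x = x₀
      · simp [hx, ht₀]
      · rw [ht x hx, mul_inv_rev, inv_inv, mul_smul, ih _ (hlt x hx), hsmul x hx]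
  · induction x using wf.induction with
    | _ x ih =>
      by_cases hx : x = x₀
      · rwa [hx]
      · have hy := ih _ (hlt x hx)
        rcases hletter x hx with ⟨i, hi⟩ | ⟨i, hi⟩
        · have hpar : (γ i)⁻¹ • x = parent x := by
            rw [hi, inv_smul_eq_iff, hsmul x hx]
          refine (hp x i ?_).2 (hpar ▸ hy)
          rw [hpar, ht x hx, hi]; group
        · have hpar : (γ i)⁻¹ • parent x = x := by rw [hi, inv_inv, hsmul x hx]
          refine hpar ▸ (hp (parent x) i ?_).1 hy
          rw [hpar, ht x hx, hi]

end SchreierTree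

section Rewriting

variable {G X ι Q : Type*} [Group G] [MulAction G X] [Group Q]

/-- The homomorphism to a wreath product that records the labels `y` read off along paths in the
Schreier graph of the action on `X`. -/
def wreathHom (γ : ι → G) (y : X × ι → Q) : FreeGroup ι →* (X → Q) ⋊[mulAutArrow] G :=
  FreeGroup.lift fun i => ⟨fun x => y (x, i), γ i⟩

/-- The product of the labels `y` along the path spelled by a word, starting at `x`. -/
def schreierRewrite (γ : ι → G) (y : X × ι → Q) (x : X) (w : FreeGroup ι) : Q :=
  (wreathHom γ y w).left x

theorem wreathHom_right (γ : ι → G) (y : X × ι → Q) (w : FreeGroup ι) :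
    (wreathHom γ y w).right = FreeGroup.lift γ w := by
  have h : SemidirectProduct.rightHom.comp (wreathHom γ y) = FreeGroup.lift γ := by
    ext i; simp [wreathHom]
  exact DFunLike.congr_fun h w

theorem semidirect_mul_left_apply (a b : (X → Q) ⋊[mulAutArrow] G) (x : X) :
    (a * b).left x = a.left x * b.left (a.right⁻¹ • x) := rfl

theorem schreierRewrite_one (γ : ι → G) (y : X × ι → Q) (x : X) :
    schreierRewrite γ y x 1 = 1 := by
  simp [schreierRewrite]

theorem schreierRewrite_of (γ : ι → G) (y : X × ι → Q) (x : X) (i : ι) :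
    schreierRewrite γ y x (FreeGroup.of i) = y (x, i) := by
  simp [schreierRewrite, wreathHom]

theorem schreierRewrite_mul (γ : ι → G) (y : X × ι → Q) (x : X) (v w : FreeGroup ι) :
    schreierRewrite γ y x (v * w) =
      schreierRewrite γ y x v * schreierRewrite γ y ((FreeGroup.lift γ v)⁻¹ • x) w := by
  rw [schreierRewrite, map_mul, semidirect_mul_left_apply, wreathHom_right]; rfl

theorem schreierRewrite_inv (γ : ι → G) (y : X × ι → Q) (x : X) (w : FreeGroup ι) :
    schreierRewrite γ y x w⁻¹ = (schreierRewrite γ y (FreeGroup.lift γ w • x) w)⁻¹ := by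
  have h := schreierRewrite_mul γ y x w⁻¹ w
  rw [inv_mul_cancel, schreierRewrite_one, map_inv, inv_inv] at h
  exact eq_inv_of_mul_eq_one_left h.symm

theorem map_schreierRewrite {Q' : Type*} [Group Q'] (f : Q →* Q') (γ : ι → G) (y : X × ι → Q)
    (x : X) (w : FreeGroup ι) :
    f (schreierRewrite γ y x w) = schreierRewrite γ (f ∘ y) x w := by
  induction w using FreeGroup.induction_on generalizing x with
  | C1 => simp [schreierRewrite_one]
  | of i => simp [schreierRewrite_of]
  | inv_of i ih => simp [schreierRewrite_inv, schreierRewrite_of]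
  | mul v w hv hw => simp [schreierRewrite_mul, hv, hw]

theorem schreierRewrite_coboundary (γ : ι → G) (t : X → G) (x : X) (w : FreeGroup ι) :
    schreierRewrite γ (fun q : X × ι => t q.1 * γ q.2 * (t ((γ q.2)⁻¹ • q.1))⁻¹) x w =
      t x * FreeGroup.lift γ w * (t ((FreeGroup.lift γ w)⁻¹ • x))⁻¹ := by
  induction w using FreeGroup.induction_on generalizing x with
  | C1 => simp [schreierRewrite_one]
  | of i => simp [schreierRewrite_of]
  | inv_of i ih => simp [schreierRewrite_inv, schreierRewrite_of, mul_assoc]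
  | mul v w hv hw =>
    rw [schreierRewrite_mul, hv, hw]
    simp [mul_assoc, mul_smul]

theorem norm_schreierRewrite_le [DecidableEq ι] [DecidableEq X] (γ : ι → G) (x : X)
    (w : FreeGroup ι) :
    (schreierRewrite γ (FreeGroup.of : X × ι → _) x w).norm ≤ w.norm := by
  have h : ∀ (L : List (ι × Bool)) (x : X),
      (schreierRewrite γ (FreeGroup.of : X × ι → _) x (FreeGroup.mk L)).norm ≤ L.length := by
    intro L
    induction L with
    | nil => intro x; simp [← FreeGroup.one_eq_mk, schreierRewrite_one]
    | cons a L ih =>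
      intro x
      have hmk : FreeGroup.mk (a :: L) = FreeGroup.mk [a] * FreeGroup.mk L := by
        simp [FreeGroup.mul_mk]
      have ha : ∀ x, (schreierRewrite γ (FreeGroup.of : X × ι → _) x (FreeGroup.mk [a])).norm
          ≤ 1 := by
        intro x
        obtain ⟨i, b⟩ := a
        cases b with
        | true =>
          change (schreierRewrite γ (FreeGroup.of : X × ι → _) x (FreeGroup.of i)).norm ≤ 1
          simp [schreierRewrite_of]
        | false =>
          change (schreierRewrite γ (FreeGroup.of : X × ι → _) x (FreeGroup.of i)⁻¹).norm ≤ 1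
          simp [schreierRewrite_inv, schreierRewrite_of]
      rw [hmk, schreierRewrite_mul, List.length_cons, add_comm]
      exact (FreeGroup.norm_mul_le _ _).trans (add_le_add (ha _) (ih _))
  have hw := h w.toWord x
  rwa [FreeGroup.mk_toWord] at hw

end Rewriting

section ReidemeisterSchreier

variable {ι : Type*} {R : Set (FreeGroup ι)}

/-- The Reidemeister-Schreier presentation of a subgroup `K`: the relators are the rewritten
relators of the ambient group and the edges of a spanning tree of the Schreier graph. -/
theorem exists_reidemeisterSchreier (K : Subgroup (PresentedGroup R)) :
    ∃ T : Set ((PresentedGroup R ⧸ K) × ι), Nonempty (K ≃* PresentedGroup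
      ({s | ∃ x : PresentedGroup R ⧸ K, ∃ r ∈ R,
          schreierRewrite (PresentedGroup.of (rels := R)) FreeGroup.of x r = s} ∪
        FreeGroup.of '' T)) := by
  let γ : ι → PresentedGroup R := PresentedGroup.of
  let X := PresentedGroup R ⧸ K
  let x₀ : X := ((1 : PresentedGroup R) : X)
  have hlift : ∀ w, FreeGroup.lift γ w = PresentedGroup.mk R w := by
    intro w
    have : FreeGroup.lift γ = PresentedGroup.mk R := by ext i; simp [γ, PresentedGroup.of]
    rw [this]
  have hK : ∀ g : PresentedGroup R, g⁻¹ • x₀ = x₀ ↔ g ∈ K := by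
    intro g
    have h : g⁻¹ • x₀ = ((g⁻¹ : PresentedGroup R) : X) :=
      congrArg QuotientGroup.mk (mul_one g⁻¹)
    rw [h, QuotientGroup.eq]; simp
  obtain ⟨t, ht₀, htx, htree⟩ :=
    exists_schreierTransversal γ (PresentedGroup.closure_range_of R) x₀
  let T : Set (X × ι) := {q | t ((γ q.2)⁻¹ • q.1) = t q.1 * γ q.2}
  let S : Set (FreeGroup (X × ι)) :=
    {s | ∃ x : X, ∃ r ∈ R, schreierRewrite γ FreeGroup.of x r = s} ∪
      FreeGroup.of '' T
  refine ⟨T, ?_⟩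
  change Nonempty (K ≃* PresentedGroup S)
  have hmem : ∀ q : X × ι, t q.1 * γ q.2 * (t ((γ q.2)⁻¹ • q.1))⁻¹ ∈ K := by
    intro q
    rw [← hK, mul_inv_rev, mul_inv_rev, inv_inv, mul_smul, mul_smul, htx, ← eq_inv_smul_iff, htx]
  let z : X × ι → K := fun q => ⟨_, hmem q⟩
  have hz : ∀ x w, ((schreierRewrite γ z x w : K) : PresentedGroup R) =
      t x * PresentedGroup.mk R w * (t ((PresentedGroup.mk R w)⁻¹ • x))⁻¹ := by
    intro x w
    rw [← hlift, ← schreierRewrite_coboundary]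
    exact map_schreierRewrite K.subtype γ z x w
  have hnat : ∀ x w,
      FreeGroup.lift z (schreierRewrite γ FreeGroup.of x w) = schreierRewrite γ z x w := by
    intro x w
    rw [map_schreierRewrite]
    congr 1
    funext q
    simp
  have hrel : ∀ s ∈ S, FreeGroup.lift z s = 1 := by
    rintro _ (⟨x, r, hr, rfl⟩ | ⟨q, hq, rfl⟩)
    · refine (hnat x r).trans (Subtype.ext ?_)
      rw [hz, PresentedGroup.one_of_mem hr]; simp
    · refine Subtype.ext ?_
      have hq' : t ((γ q.2)⁻¹ • q.1) = t q.1 * γ q.2 := hq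
      simp [z, hq']
  let toK : PresentedGroup S →* K := PresentedGroup.toGroup hrel
  let y : X × ι → PresentedGroup S := PresentedGroup.of
  have hΨ : ∀ r ∈ R, wreathHom γ y r = 1 := by
    intro r hr
    refine SemidirectProduct.ext (funext fun x => ?_) ?_
    · have h1 : PresentedGroup.mk S (schreierRewrite γ FreeGroup.of x r) = 1 :=
        PresentedGroup.one_of_mem (Or.inl ⟨x, r, hr, rfl⟩)
      rw [map_schreierRewrite] at h1
      exact h1
    · rw [wreathHom_right, hlift, PresentedGroup.one_of_mem hr]; rfl
  let Ψ : PresentedGroup R →* (X → PresentedGroup S) ⋊[mulAutArrow] PresentedGroup R :=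
    PresentedGroup.toGroup hΨ
  have hΨmk : ∀ w, Ψ (PresentedGroup.mk R w) = wreathHom γ y w := fun w => rfl
  have hΨr : ∀ g, (Ψ g).right = g := by
    intro g
    obtain ⟨w, rfl⟩ := PresentedGroup.mk_surjective R g
    rw [hΨmk, wreathHom_right, hlift]
  let c (x : X) (g : PresentedGroup R) : PresentedGroup S := (Ψ g).left x
  have hcmul : ∀ x g h, c x (g * h) = c x g * c (g⁻¹ • x) h := by
    intro x g h
    simp only [c]
    rw [map_mul, semidirect_mul_left_apply, hΨr]
  have hcγ : ∀ x i, c x (γ i) = y (x, i) := fun x i => schreierRewrite_of γ y x i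
  have hct : ∀ x, c x₀ (t x) = 1 := by
    refine htree _ ?_ ?_
    · rw [ht₀]; simp [c]
    · intro x i h
      have hy : y (x, i) = 1 := PresentedGroup.one_of_mem (Or.inr ⟨(x, i), h, rfl⟩)
      rw [h, hcmul, htx, hcγ, hy, mul_one]
  let fromK : K →* PresentedGroup S := MonoidHom.mk' (fun k => c x₀ k) (by
    intro a b
    rw [Subgroup.coe_mul, hcmul, (hK _).2 a.2])
  refine ⟨MonoidHom.toMulEquiv fromK toK ?_ ?_⟩
  · ext k
    obtain ⟨w, hw⟩ := PresentedGroup.mk_surjective R (k : PresentedGroup R)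
    have h1 : fromK k = schreierRewrite γ y x₀ w := by
      change (Ψ k).left x₀ = _
      rw [← hw]; rfl
    have h2 : toK ∘ y = z := funext fun q => PresentedGroup.toGroup.of hrel
    change ((toK (fromK k) : K) : PresentedGroup R) = k
    rw [h1, map_schreierRewrite, h2, hz, hw, (hK _).2 k.2, ht₀]
    simp
  · refine PresentedGroup.ext fun q => ?_
    have h1 : toK (PresentedGroup.of q) = z q := PresentedGroup.toGroup.of hrel
    change fromK (toK (PresentedGroup.of q)) = PresentedGroup.of q
    rw [h1]
    have h2 := hcmul x₀ (z q) (t ((γ q.2)⁻¹ • q.1))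
    rw [(hK _).2 (z q).2, hct, mul_one] at h2
    refine h2.symm.trans ?_
    simp only [z, inv_mul_cancel_right]
    rw [hcmul, hct, htx, hcγ, one_mul]

end ReidemeisterSchreier

section PresentationLength

theorem norm_freeGroup_map_le {α β : Type*} [DecidableEq α] [DecidableEq β] (f : α → β)
    (w : FreeGroup α) : (FreeGroup.map f w).norm ≤ w.norm := by
  rw [← FreeGroup.mk_toWord (x := w), FreeGroup.map.mk]
  refine FreeGroup.norm_mk_le.trans ?_
  simp [FreeGroup.norm]

theorem exists_mem_presLengthValues_le {G α : Type*} [Group G] [Finite α] [DecidableEq α]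
    (rels : List (FreeGroup α)) (e : G ≃* PresentedGroup {r | r ∈ rels}) :
    ∃ t ∈ presLengthValues G, t ≤ (rels.map fun r => r.norm - 2).sum := by
  obtain ⟨n, ⟨f⟩⟩ := Finite.exists_equiv_fin α
  refine ⟨_, ⟨n, rels.map (FreeGroup.map f), ⟨?_⟩, rfl⟩, ?_⟩
  · have h : {r | r ∈ rels.map (FreeGroup.map f)} =
        FreeGroup.freeGroupCongr f '' {r | r ∈ rels} := by
      ext r; simp [FreeGroup.freeGroupCongr]
    rw [h]
    exact e.trans (PresentedGroup.equivPresentedGroup _ f)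
  · rw [List.map_map]
    exact List.sum_le_sum fun r _ => Nat.sub_le_sub_right (norm_freeGroup_map_le f r) 2

theorem presLengthValues_subset_of_mulEquiv {G G' : Type*} [Group G] [Group G'] (e : G ≃* G') :
    presLengthValues G ⊆ presLengthValues G' := by
  rintro t ⟨n, rels, ⟨f⟩, ht⟩
  exact ⟨n, rels, ⟨e.symm.trans f⟩, ht⟩

theorem presLength_congr {G G' : Type*} [Group G] [Group G'] (e : G ≃* G') :
    presLength G = presLength G' :=
  congrArg sInf ((presLengthValues_subset_of_mulEquiv e).antisymm
    (presLengthValues_subset_of_mulEquiv e.symm))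

theorem exists_mem_presLengthValues_subgroup_le {G : Type*} [Group G] (K : Subgroup G)
    (hK : K.index ≠ 0) {t : ℕ} (ht : t ∈ presLengthValues G) :
    ∃ s ∈ presLengthValues K, s ≤ K.index * t := by
  classical
  obtain ⟨n, rels, ⟨e⟩, rfl⟩ := ht
  let K' := K.map (e : G →* PresentedGroup {r | r ∈ rels})
  have hidx : K'.index = K.index := K.index_map_equiv e
  let X := PresentedGroup {r | r ∈ rels} ⧸ K'
  have : K'.FiniteIndex := ⟨by rwa [hidx]⟩
  have : Fintype X := K'.fintypeQuotientOfFiniteIndex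
  have hcard : Fintype.card X = K.index := by
    rw [← hidx, ← Nat.card_eq_fintype_card]; rfl
  obtain ⟨T, ⟨f⟩⟩ := exists_reidemeisterSchreier K'
  let ρ (x : X) (r : FreeGroup (Fin n)) : FreeGroup (X × Fin n) :=
    schreierRewrite (PresentedGroup.of : Fin n → PresentedGroup {r | r ∈ rels}) FreeGroup.of x r
  let L₁ := (Finset.univ : Finset X).toList.flatMap fun x => rels.map (ρ x)
  let L₂ : List (FreeGroup (X × Fin n)) := T.toFinset.toList.map FreeGroup.of
  have hset : {r | r ∈ L₁ ++ L₂} =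
      {s | ∃ x, ∃ r ∈ {r | r ∈ rels}, ρ x r = s} ∪ FreeGroup.of '' T := by
    ext s; simp [L₁, L₂]
  obtain ⟨s, hs, hle⟩ := exists_mem_presLengthValues_le (G := K) (L₁ ++ L₂)
    (((e.subgroupMap K).trans f).trans (by rw [hset]))
  refine ⟨s, hs, hle.trans ?_⟩
  have h₂ : (L₂.map fun r => r.norm - 2).sum = 0 := by
    simp [L₂]
  have h₁ : ∀ l : List X, ((l.flatMap fun x => rels.map (ρ x)).map fun r => r.norm - 2).sum ≤
      l.length * (rels.map fun r => r.norm - 2).sum := by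
    intro l
    induction l with
    | nil => simp
    | cons x l ih =>
      rw [List.flatMap_cons, List.map_append, List.sum_append, List.length_cons, add_mul, one_mul,
        add_comm, List.map_map]
      exact add_le_add ih (List.sum_le_sum fun r _ =>
        Nat.sub_le_sub_right (norm_schreierRewrite_le _ x r) 2)
  rw [List.map_append, List.sum_append, h₂, add_zero, ← hcard]
  simpa using h₁ Finset.univ.toList

theorem FinitelyPresentable.subgroup {G : Type*} [Group G] (hG : FinitelyPresentable G)
    (K : Subgroup G) (hK : K.index ≠ 0) : FinitelyPresentable K := by
  obtain ⟨t, ht⟩ := hG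
  obtain ⟨s, hs, -⟩ := exists_mem_presLengthValues_subgroup_le K hK ht
  exact ⟨s, hs⟩

theorem FinitelyPresentable.presLength_subgroup_le {G : Type*} [Group G]
    (hG : FinitelyPresentable G) (K : Subgroup G) (hK : K.index ≠ 0) :
    presLength K ≤ K.index * presLength G := by
  obtain ⟨s, hs, hle⟩ := exists_mem_presLengthValues_subgroup_le K hK (Nat.sInf_mem hG)
  exact (Nat.sInf_le hs).trans hle

theorem presLength_subgroupOf_comm {G : Type*} [Group G] (H L : Subgroup G) :
    presLength (L.subgroupOf H) = presLength (H.subgroupOf L) := by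
  rw [← Subgroup.inf_subgroupOf_right L H, ← Subgroup.inf_subgroupOf_left H L]
  exact presLength_congr ((Subgroup.subgroupOfEquivOfLe inf_le_right).trans
    (Subgroup.subgroupOfEquivOfLe inf_le_left).symm)

theorem stablePresLength_le {G : Type*} [Group G] (K : Subgroup G) (hK : K.index ≠ 0) :
    stablePresLength G ≤ presLength K / K.index :=
  csInf_le ⟨0, by rintro _ ⟨K, -, rfl⟩; positivity⟩ ⟨K, hK, rfl⟩

theorem le_stablePresLength {G : Type*} [Group G] {a : ℝ}
    (h : ∀ K : Subgroup G, K.index ≠ 0 → a ≤ presLength K / K.index) :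
    a ≤ stablePresLength G :=
  le_csInf ⟨_, ⊤, by simp, rfl⟩ (by rintro _ ⟨K, hK, rfl⟩; exact h K hK)

end PresentationLength

/-- The stable presentation length is multiplicative on finite-index subgroups:
`T_∞(H) = [G:H] · T_∞(G)`. -/
theorem stablePresLength_finiteIndex_subgroup (G : Type*) [Group G]
    (hG : FinitelyPresentable G) (H : Subgroup G) (hH : H.index ≠ 0) :
    stablePresLength H = (H.index : ℝ) * stablePresLength G := by
  have hd : (0 : ℝ) < H.index := by positivity
  refine le_antisymm ?_ (le_stablePresLength fun K hK => ?_)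
  · rw [← div_le_iff₀' hd]
    refine le_stablePresLength fun L hL => ?_
    have : H.FiniteIndex := ⟨hH⟩
    have : L.FiniteIndex := ⟨hL⟩
    have hHL : H.relIndex L ≠ 0 := H.isFiniteRelIndex_of_finiteIndex.relIndex_ne_zero
    have hLH : L.relIndex H ≠ 0 := L.isFiniteRelIndex_of_finiteIndex.relIndex_ne_zero
    have hmul : (L.relIndex H * H.index : ℝ) = H.relIndex L * L.index := by
      have h1 := Subgroup.relIndex_mul_index (inf_le_right : L ⊓ H ≤ H)
      have h2 := Subgroup.relIndex_mul_index (inf_le_left : L ⊓ H ≤ L)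
      rw [Subgroup.inf_relIndex_right] at h1
      rw [Subgroup.inf_relIndex_left] at h2
      exact_mod_cast h1.trans h2.symm
    have hle : (presLength (L.subgroupOf H) : ℝ) ≤ H.relIndex L * presLength L := by
      rw [presLength_subgroupOf_comm]
      exact_mod_cast (hG.subgroup L hL).presLength_subgroup_le (H.subgroupOf L) hHL
    have hHL' : (0 : ℝ) < H.relIndex L := by positivity
    have hL' : (0 : ℝ) < L.index := by positivity
    calc stablePresLength H / H.index
        ≤ presLength (L.subgroupOf H) / L.relIndex H / H.index := by
          gcongr
          exact stablePresLength_le (L.subgroupOf H) hLH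
      _ = presLength (L.subgroupOf H) / (H.relIndex L * L.index) := by rw [div_div, hmul]
      _ ≤ H.relIndex L * presLength L / (H.relIndex L * L.index) := by gcongr
      _ = presLength L / L.index := mul_div_mul_left _ _ hHL'.ne'
  · have hK' : (K.map H.subtype).index ≠ 0 := by
      rw [Subgroup.index_map_subtype]; exact mul_ne_zero hK hH
    have h := stablePresLength_le (K.map H.subtype) hK'
    rw [Subgroup.index_map_subtype, Nat.cast_mul, ← div_div, le_div_iff₀' hd,
      ← presLength_congr (K.equivMapOfInjective H.subtype H.subtype_injective)] at h
    exact h
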